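/- For all time warps f and g, last (f ∘ g) = ⊤ if, and only if, last g = ⊤ and last f = ⊤. -/

import Mathlib

/-- A map `f : ℕ∞ → ℕ∞` preserves arbitrary suprema. -/
def PreservesSSup (f : ℕ∞ → ℕ∞) : Prop :=
  ∀ S : Set ℕ∞, f (sSup S) = sSup (f '' S)

/-- `last f = sInf {m | f m = f ⊤}`. -/
noncomputable def wlast (f : ℕ∞ → ℕ∞) : ℕ∞ := sInf {m | f m = f ⊤}

theorem PreservesSSup.monotone {f : ℕ∞ → ℕ∞} (hf : PreservesSSup f) : Monotone f := by
  intro a b hab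
  have h := hf {a, b}
  rw [sSup_pair, sup_eq_right.mpr hab, Set.image_pair, sSup_pair] at h
  exact h ▸ le_sup_left

theorem PreservesSSup.map_top {f : ℕ∞ → ℕ∞} (hf : PreservesSSup f) :
    f ⊤ = sSup (f '' Set.Iio ⊤) := by
  have h : sSup (Set.Iio (⊤ : ℕ∞)) = ⊤ :=
    sSup_eq_top.mpr fun b hb => ⟨b + 1, by simpa using hb, ENat.lt_add_one_iff hb.ne |>.mpr le_rfl⟩
  rw [← hf, h]

theorem wlast_eq_top_iff {f : ℕ∞ → ℕ∞} : wlast f = ⊤ ↔ ∀ m, f m = f ⊤ → m = ⊤ :=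
  sInf_eq_top

theorem PreservesSSup.map_top_of_wlast_eq_top {f : ℕ∞ → ℕ∞} (hf : PreservesSSup f)
    (h : wlast f = ⊤) : f ⊤ = ⊤ := by
  rw [wlast_eq_top_iff] at h
  by_contra hne
  have hmem : sSup (f '' Set.Iio ⊤) ∈ f '' Set.Iio ⊤ :=
    have : Nonempty (f '' Set.Iio ⊤) := (Set.Nonempty.image f ⟨0, ENat.top_pos⟩).to_subtype
    ENat.sSup_mem_of_nonempty_of_lt_top (hf.map_top ▸ lt_top_iff_ne_top.mpr hne)
  rw [← hf.map_top] at hmem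
  obtain ⟨m, hm, hfm⟩ := hmem
  exact hm.ne (h m hfm)

theorem stmt8 (f g : ℕ∞ → ℕ∞) (hf : PreservesSSup f) (hg : PreservesSSup g) :
    wlast (f ∘ g) = ⊤ ↔ wlast g = ⊤ ∧ wlast f = ⊤ := by
  constructor
  · intro h
    rw [wlast_eq_top_iff] at h
    have hglast : wlast g = ⊤ := wlast_eq_top_iff.mpr fun m hm => h m (congrArg f hm)
    have hgtop := hg.map_top_of_wlast_eq_top hglast
    refine ⟨hglast, wlast_eq_top_iff.mpr fun n hn => ?_⟩
    by_contra hne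
    have hlt : n < sSup (g '' Set.Iio ⊤) := by
      rw [← hg.map_top, hgtop]
      exact lt_top_iff_ne_top.mpr hne
    obtain ⟨_, ⟨m, hm, rfl⟩, hnm⟩ := lt_sSup_iff.mp hlt
    refine hm.ne (h m ?_)
    rw [Function.comp_apply, Function.comp_apply, hgtop]
    exact le_antisymm (hf.monotone le_top) (hn ▸ hf.monotone hnm.le)
  · rintro ⟨hglast, hflast⟩
    have hgtop := hg.map_top_of_wlast_eq_top hglast
    rw [wlast_eq_top_iff] at hglast hflast ⊢
    intro m hm
    rw [Function.comp_apply, Function.comp_apply, hgtop] at hm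
    exact hglast m ((hflast _ hm).trans hgtop.symm)
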